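/- Let x be a real number that is not an integer, let α ∈ (0,1), and let H ≥ 3. Then e(-α·{x}) = Σ_{|h| ≤ H} c_h(α)·e(hx) + O(min(1, 1/(H·‖x‖))), where c_h(α) = (1 - e(-α)) / (2πi(h + α)) and the implied constant is absolute. -/

import Mathlib

open scoped Classical
open Finset Real

/-- `eC x = e(x) = e^{2πix}`. -/
noncomputable def eC (x : ℝ) : ℂ := Complex.exp ((2 * Real.pi * x : ℝ) * Complex.I)

lemma norm_eC (x : ℝ) : ‖eC x‖ = 1 := Complex.norm_exp_ofReal_mul_I _

lemma eC_add (x y : ℝ) : eC (x + y) = eC x * eC y := by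
  simp only [eC, ← Complex.exp_add]
  congr 1
  push_cast
  ring

lemma eC_int (n : ℤ) : eC n = 1 := by
  rw [eC, Complex.exp_eq_one_iff]
  exact ⟨n, by push_cast; ring⟩

lemma eC_zero : eC 0 = 1 := by simp [eC]

lemma continuous_eC : Continuous eC := by
  unfold eC
  fun_prop

lemma norm_eC_sub_one (x : ℝ) : ‖eC x - 1‖ = ‖2 * Real.sin (π * x)‖ := by
  rw [eC, mul_comm, Complex.norm_exp_I_mul_ofReal_sub_one]
  congr 3
  ring

lemma norm_eC_sub_le (x y : ℝ) : ‖eC x - eC y‖ ≤ 2 * π * |x - y| := by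
  have h : eC x - eC y = eC y * (eC (x - y) - 1) := by
    rw [mul_sub, ← eC_add]
    simp
  rw [h, norm_mul, norm_eC, one_mul, eC, mul_comm]
  refine Real.norm_exp_I_mul_ofReal_sub_one_le.trans_eq ?_
  rw [Real.norm_eq_abs, abs_mul, abs_of_pos (by positivity)]

lemma four_mul_min_le_norm_eC_sub_one {x : ℝ} (h0 : 0 ≤ x) (h1 : x ≤ 1) :
    4 * min x (1 - x) ≤ ‖eC x - 1‖ := by
  have key : ∀ y : ℝ, 0 ≤ y → y ≤ 1 / 2 → 2 * y ≤ Real.sin (π * y) := by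
    intro y hy hy'
    have := Real.mul_le_sin (x := π * y) (by positivity) (by nlinarith [Real.pi_pos])
    rwa [← mul_assoc, div_mul_cancel₀ _ Real.pi_ne_zero] at this
  rw [norm_eC_sub_one, Real.norm_eq_abs]
  refine le_trans ?_ (le_abs_self _)
  rcases le_total x (1 / 2) with h | h
  · linarith [key x h0 h, min_le_left x (1 - x)]
  · have := key (1 - x) (by linarith) (by linarith)
    rw [show π * (1 - x) = π - π * x by ring, Real.sin_pi_sub] at this
    linarith [min_le_right x (1 - x)]

/-- The Fourier coefficients of the one-periodic function equal to `e(-αx)` on `[0, 1)`. -/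
noncomputable def expCoeff (α : ℝ) (h : ℤ) : ℂ :=
  (1 - eC (-α)) / (2 * Real.pi * Complex.I * ((h : ℂ) + (α : ℂ)))

lemma int_add_ne_zero {α : ℝ} (h0 : 0 < α) (h1 : α < 1) (h : ℤ) : (h : ℝ) + α ≠ 0 := by
  intro h'
  have a : (-1 : ℝ) < h := by linarith
  have b : (h : ℝ) < 0 := by linarith
  have a' : -1 < h := by exact_mod_cast a
  have b' : h < 0 := by exact_mod_cast b
  omega

lemma norm_expCoeff_le (α : ℝ) (h : ℤ) : ‖expCoeff α h‖ ≤ 1 / (π * |(h : ℝ) + α|) := by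
  have hc : (h : ℂ) + (α : ℂ) = ((h + α : ℝ) : ℂ) := by push_cast; rfl
  have hn : ‖1 - eC (-α)‖ ≤ 2 := by
    refine (norm_sub_le _ _).trans ?_
    rw [norm_eC, norm_one]
    norm_num
  rw [expCoeff, hc, norm_div, norm_mul, norm_mul, norm_mul, Complex.norm_I, Complex.norm_real,
    Complex.norm_real, Real.norm_eq_abs, Real.norm_eq_abs, abs_of_pos Real.pi_pos]
  calc _ ≤ 2 / (‖(2 : ℂ)‖ * π * 1 * |(h : ℝ) + α|) := by gcongr
    _ = _ := by
      rw [Complex.norm_ofNat, mul_one, mul_assoc, div_mul_eq_div_div, div_self two_ne_zero]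

lemma norm_expCoeff_sub_le {α : ℝ} (h0 : 0 < α) (h1 : α < 1) (h : ℤ) :
    ‖expCoeff α h - expCoeff α (h - 1)‖ ≤ 1 / (|(h : ℝ) + α| * |(h : ℝ) - 1 + α|) := by
  have a := int_add_ne_zero h0 h1 h
  have b := int_add_ne_zero h0 h1 (h - 1)
  have a' : (h : ℂ) + (α : ℂ) ≠ 0 := by exact_mod_cast a
  have b' : (h : ℂ) - 1 + (α : ℂ) ≠ 0 := by exact_mod_cast b
  have e : expCoeff α h - expCoeff α (h - 1) =
      -expCoeff α h * (((h : ℝ) - 1 + α : ℝ) : ℂ)⁻¹ := by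
    have := Real.pi_ne_zero
    simp only [expCoeff]
    push_cast
    field_simp
    ring
  rw [e, norm_mul, norm_neg, norm_inv, Complex.norm_real, Real.norm_eq_abs]
  have hp : 1 ≤ π := by linarith [Real.pi_gt_three]
  calc _ ≤ 1 / (π * |(h : ℝ) + α|) * |(h : ℝ) - 1 + α|⁻¹ := by
        gcongr
        exact norm_expCoeff_le α h
    _ ≤ 1 / (1 * |(h : ℝ) + α|) * |(h : ℝ) - 1 + α|⁻¹ := by gcongr
    _ = _ := by rw [one_mul, ← div_eq_mul_inv, div_div]

lemma summable_expCoeff_sub {α : ℝ} (h0 : 0 < α) (h1 : α < 1) :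
    Summable fun h : ℤ => expCoeff α h - expCoeff α (h - 1) := by
  have s := fun b : ℝ => (Real.summable_one_div_int_add_rpow b 2).2 (by norm_num)
  refine ((s α).add (s (-1 + α))).of_norm_bounded fun h => ?_
  refine (norm_expCoeff_sub_le h0 h1 h).trans ?_
  rw [Real.rpow_two, Real.rpow_two, ← add_assoc, ← sub_eq_add_neg]
  have k : ∀ u v : ℝ, 1 / (u * v) ≤ 1 / u ^ 2 + 1 / v ^ 2 := by
    intro u v
    simp only [one_div, mul_inv, ← inv_pow]
    nlinarith [sq_nonneg (u⁻¹ - v⁻¹), sq_nonneg (u⁻¹), sq_nonneg (v⁻¹)]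
  exact k _ _

lemma integral_eC_mul {b : ℝ} (hb : b ≠ 0) :
    ∫ t in (0 : ℝ)..1, eC (-b * t) = (1 - eC (-b)) / (2 * π * Complex.I * b) := by
  have hc : (-(2 * π * Complex.I * b) : ℂ) ≠ 0 := by
    simp [hb, Real.pi_ne_zero]
  have := integral_exp_mul_complex (a := 0) (b := 1) hc
  have e : ∀ t : ℝ, eC (-b * t) = Complex.exp (-(2 * π * Complex.I * b) * t) := by
    intro t
    rw [eC]
    congr 1
    push_cast
    ring
  simp only [e, this]
  have e1 : eC (-b) = Complex.exp (-(2 * π * Complex.I * b)) := by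
    simpa using e 1
  rw [e1, div_neg, ← neg_div]
  simp

lemma integral_eC_eq_expCoeff {α : ℝ} (h0 : 0 < α) (h1 : α < 1) (n : ℤ) :
    ∫ t in (0 : ℝ)..1, eC (-(n + α) * t) = expCoeff α n := by
  rw [integral_eC_mul (int_add_ne_zero h0 h1 n), expCoeff]
  have : eC (-(n + α)) = eC (-α) := by
    have := eC_int (-n)
    push_cast at this
    rw [neg_add, eC_add, this, one_mul]
  rw [this]
  push_cast
  rfl

/-- Multiplying by `1 - e(x)` removes the jump at the integers, so the Fourier series of the
product converges to it pointwise. -/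
lemma hasSum_expCoeff_sub {α x : ℝ} (h0 : 0 < α) (h1 : α < 1) (hx0 : 0 ≤ x) (hx1 : x < 1) :
    HasSum (fun h : ℤ => (expCoeff α h - expCoeff α (h - 1)) * eC (h * x))
      ((1 - eC x) * eC (-α * x)) := by
  set f : ℝ → ℂ := fun t => (1 - eC t) * eC (-α * t) with hf
  have hcont : Continuous f := by
    have := continuous_eC
    fun_prop
  have e1 : eC 1 = 1 := by simpa using eC_int 1
  have hL : Continuous (AddCircle.liftIco (1 : ℝ) 0 f) :=
    AddCircle.liftIco_continuous (by simp [hf, eC_zero, e1]) hcont.continuousOn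
  have hfour : ∀ (n : ℤ) (t : ℝ), fourier n (t : AddCircle (1 : ℝ)) = eC (n * t) := by
    intro n t
    rw [fourier_coe_apply, eC]
    congr 1
    push_cast
    ring
  have hco : ∀ n : ℤ, fourierCoeff (AddCircle.liftIco (1 : ℝ) 0 f) n =
      expCoeff α n - expCoeff α (n - 1) := by
    intro n
    rw [fourierCoeff_eq_intervalIntegral _ _ 0, zero_add, div_one, one_smul,
      ← integral_eC_eq_expCoeff h0 h1, ← integral_eC_eq_expCoeff h0 h1,
      ← intervalIntegral.integral_sub]
    · refine intervalIntegral.integral_congr_Ioo_of_le zero_le_one fun t ht => ?_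
      rw [AddCircle.liftIco_coe_apply (by simpa using Set.Ioo_subset_Ico_self ht), hfour,
        smul_eq_mul]
      simp only [hf]
      rw [sub_mul, mul_sub, one_mul, ← eC_add, ← eC_add, ← eC_add]
      congr 2 <;> push_cast <;> ring
    · exact (continuous_eC.comp (by fun_prop)).intervalIntegrable _ _
    · exact (continuous_eC.comp (by fun_prop)).intervalIntegrable _ _
  have hs : Summable (fourierCoeff (⟨_, hL⟩ : C(AddCircle (1 : ℝ), ℂ))) :=
    (summable_expCoeff_sub h0 h1).congr fun n => (hco n).symm
  have := has_pointwise_sum_fourier_series_of_summable hs (x : AddCircle (1 : ℝ))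
  simp only [ContinuousMap.coe_mk, hco, hfour, smul_eq_mul] at this
  rwa [AddCircle.liftIco_coe_apply (by simpa using ⟨hx0, hx1⟩)] at this

lemma sum_Icc_neg_succ (f : ℤ → ℂ) (M : ℕ) :
    ∑ h ∈ Finset.Icc (-((M + 1 : ℕ) : ℤ)) ((M + 1 : ℕ) : ℤ), f h =
      ∑ h ∈ Finset.Icc (-(M : ℤ)) (M : ℤ), f h + (f (M + 1) + f (-(M + 1))) := by
  push_cast
  rw [Finset.Icc_succ_succ, Finset.sum_union, Finset.sum_pair, add_comm (f (M + 1))]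
  · omega
  · rw [Finset.disjoint_left]
    intro a ha hb
    simp only [Finset.mem_Icc, Finset.mem_insert, Finset.mem_singleton] at ha hb
    omega

lemma sum_Icc_sub_shift (u : ℤ → ℂ) (w : ℂ) (M : ℕ) :
    ∑ h ∈ Finset.Icc (-(M : ℤ)) (M : ℤ), (u h - w * u (h - 1)) =
      (1 - w) * ∑ h ∈ Finset.Icc (-(M : ℤ)) (M : ℤ), u h + w * (u M - u (-(M + 1))) := by
  induction M with
  | zero => simp; ring
  | succ M ih =>
    rw [sum_Icc_neg_succ, sum_Icc_neg_succ, ih]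
    have e1 : (M : ℤ) + 1 - 1 = M := by ring
    have e2 : (-((M : ℤ) + 1) - 1) = -(((M + 1 : ℕ) : ℤ) + 1) := by push_cast; ring
    rw [e1, e2]
    push_cast
    ring

/-- A function whose increments at `±(M + 1)` are `O(1 / M²)` has symmetric tail `O(1 / N)`. -/
lemma norm_hasSum_sub_sum_Icc_le {f : ℤ → ℂ} {F : ℂ} (hF : HasSum f F)
    (hf : ∀ M : ℕ, 0 < M → ‖f (M + 1)‖ + ‖f (-(M + 1))‖ ≤ 2 / ((M : ℝ) * (M + 1)))
    {N : ℕ} (hN : 0 < N) :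
    ‖F - ∑ h ∈ Finset.Icc (-(N : ℤ)) (N : ℤ), f h‖ ≤ 2 / N := by
  have hT := (hF.comp Finset.tendsto_Icc_neg).sub_const (∑ h ∈ Finset.Icc (-(N : ℤ)) (N : ℤ), f h)
  refine le_of_tendsto hT.norm ?_
  filter_upwards [Filter.eventually_ge_atTop N] with M hM
  have key : ‖∑ h ∈ Finset.Icc (-(M : ℤ)) (M : ℤ), f h -
      ∑ h ∈ Finset.Icc (-(N : ℤ)) (N : ℤ), f h‖ ≤ 2 / N - 2 / M := by
    induction M, hM using Nat.le_induction with
    | base => simp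
    | succ M hM ih =>
      have hM0 : 0 < M := hN.trans_le hM
      have hM' : (0 : ℝ) < M := by exact_mod_cast hM0
      rw [sum_Icc_neg_succ, add_sub_right_comm]
      refine (norm_add_le _ _).trans ?_
      have h2 := (norm_add_le (f (M + 1)) (f (-(M + 1)))).trans (hf M hM0)
      have e : 2 / ((M : ℝ) * (M + 1)) = 2 / M - 2 / (M + 1 : ℕ) := by
        push_cast
        field_simp
        ring
      linarith
  have : (0 : ℝ) ≤ 2 / M := by positivity
  exact key.trans (by linarith)

lemma norm_one_sub_mul_error_le {α x : ℝ} (h0 : 0 < α) (h1 : α < 1) (hx0 : 0 ≤ x) (hx1 : x < 1)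
    {N : ℕ} (hN : 0 < N) :
    ‖(1 - eC x) * (eC (-α * x) -
      ∑ h ∈ Finset.Icc (-(N : ℤ)) (N : ℤ), expCoeff α h * eC (h * x))‖ ≤ 4 / N := by
  have hN' : (0 : ℝ) < N := by exact_mod_cast hN
  have htail := norm_hasSum_sub_sum_Icc_le (hasSum_expCoeff_sub h0 h1 hx0 hx1) (fun M hM => by
    have hM' : (0 : ℝ) < M := by exact_mod_cast hM
    rw [norm_mul, norm_mul, norm_eC, norm_eC, mul_one, mul_one]
    have b1 := norm_expCoeff_sub_le h0 h1 (M + 1)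
    have b2 := norm_expCoeff_sub_le h0 h1 (-(M + 1))
    have c1 : 1 / (|((M + 1 : ℤ) : ℝ) + α| * |((M + 1 : ℤ) : ℝ) - 1 + α|) ≤
        1 / ((M : ℝ) * (M + 1)) := by
      push_cast
      rw [abs_of_pos (by linarith), abs_of_pos (by linarith), mul_comm (M : ℝ)]
      refine one_div_le_one_div_of_le (by positivity) ?_
      exact mul_le_mul (by linarith) (by linarith) (by positivity) (by linarith)
    have c2 : 1 / (|((-(M + 1) : ℤ) : ℝ) + α| * |((-(M + 1) : ℤ) : ℝ) - 1 + α|) ≤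
        1 / ((M : ℝ) * (M + 1)) := by
      push_cast
      rw [abs_of_neg (by linarith), abs_of_neg (by linarith)]
      refine one_div_le_one_div_of_le (by positivity) ?_
      exact mul_le_mul (by linarith) (by linarith) (by positivity) (by linarith)
    have e : 2 / ((M : ℝ) * (M + 1)) = 1 / ((M : ℝ) * (M + 1)) + 1 / ((M : ℝ) * (M + 1)) := by
      ring
    linarith) hN
  have hsum := sum_Icc_sub_shift (fun h => expCoeff α h * eC (h * x)) (eC x) N
  have hterm : ∀ h : ℤ, expCoeff α h * eC (h * x) -
      eC x * (expCoeff α (h - 1) * eC ((h - 1 : ℤ) * x)) =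
      (expCoeff α h - expCoeff α (h - 1)) * eC (h * x) := by
    intro h
    have : eC (h * x) = eC x * eC ((h - 1 : ℤ) * x) := by
      rw [← eC_add]
      congr 1
      push_cast
      ring
    rw [this]
    ring
  simp only [hterm] at hsum
  rw [hsum] at htail
  have hp : 1 ≤ π := by linarith [Real.pi_gt_three]
  have d1 : ‖expCoeff α N‖ ≤ 1 / N := by
    refine (norm_expCoeff_le α N).trans ?_
    push_cast
    rw [abs_of_pos (by linarith)]
    exact one_div_le_one_div_of_le hN' (by nlinarith)
  have d2 : ‖expCoeff α (-(N + 1))‖ ≤ 1 / N := by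
    refine (norm_expCoeff_le α _).trans ?_
    push_cast
    rw [abs_of_neg (by linarith)]
    exact one_div_le_one_div_of_le hN' (by nlinarith)
  have hb : ‖eC x * (expCoeff α N * eC ((N : ℤ) * x) -
      expCoeff α (-(N + 1)) * eC ((-(N + 1) : ℤ) * x))‖ ≤ 2 / N := by
    rw [norm_mul, norm_eC, one_mul]
    refine (norm_sub_le _ _).trans ?_
    rw [norm_mul, norm_mul, norm_eC, norm_eC, mul_one, mul_one]
    have e : 2 / (N : ℝ) = 1 / N + 1 / N := by ring
    linarith
  have e : 4 / (N : ℝ) = 2 / N + 2 / N := by ring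
  rw [e]
  refine le_trans (le_of_eq ?_) ((norm_add_le _ _).trans (add_le_add htail hb))
  congr 1
  ring

lemma norm_error_le {α x : ℝ} (h0 : 0 < α) (h1 : α < 1) (hx0 : 0 < x) (hx1 : x < 1)
    {N : ℕ} (hN : 0 < N) :
    ‖eC (-α * x) - ∑ h ∈ Finset.Icc (-(N : ℤ)) (N : ℤ), expCoeff α h * eC (h * x)‖ ≤
      1 / (N * min x (1 - x)) := by
  have hN' : (0 : ℝ) < N := by exact_mod_cast hN
  have hm : 0 < min x (1 - x) := lt_min hx0 (by linarith)
  have h := norm_one_sub_mul_error_le h0 h1 hx0.le hx1 hN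
  have hs := four_mul_min_le_norm_eC_sub_one hx0.le hx1.le
  rw [norm_mul, norm_sub_rev] at h
  rw [le_div_iff₀ (by positivity)]
  rw [le_div_iff₀ hN'] at h
  set R := ‖eC (-α * x) - ∑ h ∈ Finset.Icc (-(N : ℤ)) (N : ℤ), expCoeff α h * eC (h * x)‖
  have hR : 0 ≤ R * N := by positivity
  nlinarith [mul_le_mul_of_nonneg_right hs hR]

/-- After multiplication by `e(αx)` the error term has derivative bounded by the number of
summands. -/
lemma norm_error_le_add {α : ℝ} (h0 : 0 < α) (h1 : α < 1) (x y : ℝ) (N : ℕ) :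
    ‖eC (-α * x) - ∑ h ∈ Finset.Icc (-(N : ℤ)) (N : ℤ), expCoeff α h * eC (h * x)‖ ≤
      ‖eC (-α * y) - ∑ h ∈ Finset.Icc (-(N : ℤ)) (N : ℤ), expCoeff α h * eC (h * y)‖ +
        (2 * N + 1) * (2 * |x - y|) := by
  have hmul : ∀ t : ℝ, ‖eC (-α * t) -
      ∑ h ∈ Finset.Icc (-(N : ℤ)) (N : ℤ), expCoeff α h * eC (h * t)‖ =
      ‖1 - ∑ h ∈ Finset.Icc (-(N : ℤ)) (N : ℤ), expCoeff α h * eC ((h + α) * t)‖ := by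
    intro t
    rw [← one_mul ‖eC (-α * t) - _‖, ← norm_eC (α * t), ← norm_mul, mul_sub, ← eC_add,
      Finset.mul_sum]
    congr 2
    · rw [← eC_zero]
      congr 1
      ring
    · refine Finset.sum_congr rfl fun h _ => ?_
      rw [add_mul, eC_add]
      ring
  rw [hmul, hmul]
  have hdiff : ‖∑ h ∈ Finset.Icc (-(N : ℤ)) (N : ℤ), expCoeff α h * eC ((h + α) * y) -
      ∑ h ∈ Finset.Icc (-(N : ℤ)) (N : ℤ), expCoeff α h * eC ((h + α) * x)‖ ≤
      (2 * N + 1) * (2 * |x - y|) := by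
    rw [← Finset.sum_sub_distrib]
    refine (norm_sum_le_of_le (n := fun _ => 2 * |x - y|) _ fun h _ => ?_).trans_eq ?_
    · have hne := int_add_ne_zero h0 h1 h
      rw [← mul_sub, norm_mul]
      calc _ ≤ 1 / (π * |(h : ℝ) + α|) * (2 * π * |(h + α) * y - (h + α) * x|) := by
            gcongr
            · exact norm_expCoeff_le α h
            · exact norm_eC_sub_le _ _
        _ = 2 * |x - y| := by
            rw [← mul_sub, abs_mul, abs_sub_comm y x]
            have := abs_pos.2 hne
            have := Real.pi_pos
            field_simp
    · rw [Finset.sum_const, Int.card_Icc, nsmul_eq_mul]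
      congr 1
      have : ((N : ℤ) + 1 - -(N : ℤ)).toNat = 2 * N + 1 := by omega
      rw [this]
      push_cast
      ring
  refine le_trans (le_of_eq ?_) ((norm_add_le _ _).trans (add_le_add le_rfl hdiff))
  congr 1
  ring

theorem stmt_8 :
    ∃ C > 0, ∀ x α H : ℝ, (¬ ∃ n : ℤ, (n : ℝ) = x) → 0 < α → α < 1 → 3 ≤ H →
      ‖eC (-α * Int.fract x) -
          ∑ h ∈ Finset.Icc (-⌊H⌋) ⌊H⌋,
            (1 - eC (-α)) / (2 * Real.pi * Complex.I * ((h : ℂ) + (α : ℂ))) *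
              eC ((h : ℝ) * x)‖
        ≤ C * min 1 (1 / (H * |x - round x|)) := by
  refine ⟨10, by norm_num, fun x α H hx h0 h1 hH => ?_⟩
  have hfl : 3 ≤ ⌊H⌋ := Int.le_floor.2 (by exact_mod_cast hH)
  obtain ⟨N, hN⟩ := Int.eq_ofNat_of_zero_le (show 0 ≤ ⌊H⌋ by omega)
  have hN0 : 0 < N := by omega
  have hN' : (0 : ℝ) < N := by exact_mod_cast hN0
  have hNH : (N : ℝ) ≤ H := by
    have := Int.floor_le H
    rw [hN] at this
    exact_mod_cast this
  have hHN : H ≤ 2 * N := by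
    have := Int.lt_floor_add_one H
    rw [hN] at this
    have h3 : (1 : ℝ) ≤ N := by exact_mod_cast hN0
    push_cast at this
    linarith
  have hper : ∀ h : ℤ, eC ((h : ℝ) * x) = eC (h * Int.fract x) := by
    intro h
    have : (h : ℝ) * x = (h * ⌊x⌋ : ℤ) + h * Int.fract x := by
      push_cast
      rw [← mul_add, Int.floor_add_fract]
    rw [this, eC_add, eC_int, one_mul]
  have ht0 : 0 < Int.fract x :=
    (Int.fract_nonneg x).lt_of_ne' fun h => hx (Int.fract_eq_zero_iff.1 h)
  have ht1 := Int.fract_lt_one x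
  simp only [hper, hN, abs_sub_round_eq_min]
  generalize Int.fract x = t at ht0 ht1
  have hm : 0 < min t (1 - t) := lt_min ht0 (by linarith)
  have hH0 : 0 < H := by linarith
  have decay : ∀ s : ℝ, 0 < s → s < 1 → ‖eC (-α * s) -
      ∑ h ∈ Finset.Icc (-(N : ℤ)) (N : ℤ), expCoeff α h * eC (h * s)‖ ≤
        2 * (1 / (H * min s (1 - s))) := by
    intro s hs0 hs1
    have hs : 0 < min s (1 - s) := lt_min hs0 (by linarith)
    refine (norm_error_le h0 h1 hs0 hs1 hN0).trans ?_
    rw [← div_eq_mul_one_div, div_le_div_iff₀ (by positivity) (by positivity)]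
    nlinarith
  change ‖eC (-α * t) -
      ∑ h ∈ Finset.Icc (-(N : ℤ)) (N : ℤ), expCoeff α h * eC (h * t)‖ ≤ _
  rw [mul_min_of_nonneg _ _ (by norm_num : (0 : ℝ) ≤ 10), mul_one]
  refine le_min ?_ ((decay t ht0 ht1).trans ?_)
  · obtain ⟨s, hs0, hs1, hs, hst⟩ : ∃ s : ℝ, 0 < s ∧ s < 1 ∧ 1 / H ≤ min s (1 - s) ∧
        |t - s| ≤ 1 / H := by
      have hi : 0 < 1 / H := by positivity
      have hi3 : 1 / H ≤ 1 / 3 := one_div_le_one_div_of_le (by norm_num) hH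
      by_cases ha : t < 1 / H
      · refine ⟨1 / H, hi, by linarith, le_min le_rfl (by linarith), ?_⟩
        rw [abs_le]
        constructor <;> linarith
      by_cases hb : 1 - t < 1 / H
      · refine ⟨1 - 1 / H, by linarith, by linarith, le_min (by linarith) (by linarith), ?_⟩
        rw [abs_le]
        constructor <;> linarith
      · exact ⟨t, ht0, ht1, le_min (by linarith) (by linarith), by simpa using hi.le⟩
    have hsH : 1 ≤ H * min s (1 - s) := by
      rwa [div_le_iff₀' hH0] at hs
    have b1 : 1 / (H * min s (1 - s)) ≤ 1 := by
      rw [div_le_one (by linarith)]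
      exact hsH
    have b2 : (2 * N + 1) * (2 * |t - s|) ≤ 8 := by
      calc (2 * N + 1) * (2 * |t - s|) ≤ (2 * H + H) * (2 * (1 / H)) := by
            gcongr
            linarith
        _ = 6 := by
            field_simp
            norm_num
        _ ≤ 8 := by norm_num
    linarith [norm_error_le_add h0 h1 t s N, decay s hs0 hs1]
  · gcongr
    norm_num
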